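/- Let n ≥ 1, let Ω ⊆ ℂⁿ be a bounded simply connected complete Reinhardt domain, H a complex Hilbert space, Y a complex Banach space, and U : B(H) → Y a nonzero bounded linear operator with ‖U‖ < λ, where λ > 1 and 1 ≤ p < ∞. Set D := max{ (1/(4λ·2^{1/p}))·((λ^p − ‖U‖^p)/(2λ^p − ‖U‖^p))^{1/p}, (1/(4λ·2^{1/p}))·((λ^p − ‖U‖^p)/(λ^p − ‖U‖^p + 1))^{1/p}·(1/‖U‖) } if ‖U‖ ≥ 1/(4λ·2^{1/p}), and D := max{ (1/(4λ·2^{1/p}))·((λ^p − ‖U‖^p)/(2λ^p − ‖U‖^p))^{1/p}, (1/(4λ·2^{1/p}))·((λ^p − ‖U‖^p)/(λ^p − ‖U‖^p + 1))^{1/p} } if 0 < ‖U‖ < 1/(4λ·2^{1/p}). Then L_λ(Ω,p,U) ≥ D · n^{−1/p} / (S(Ω,𝔻ⁿ)·S(𝔻ⁿ,Ω)). -/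

import Mathlib

open scoped ENNReal Pointwise
open Filter

noncomputable section

namespace BohrPaper

/-- The monomial `z^α = z₁^{α₁} ⋯ z_n^{α_n}`. -/
def mpow {n : ℕ} (z : Fin n → ℂ) (α : Fin n → ℕ) : ℂ := ∏ j, z j ^ α j

/-- A complete Reinhardt domain in `ℂⁿ`: nonempty, open, connected and closed under
componentwise decrease of moduli. -/
def IsCompleteReinhardt {n : ℕ} (Ω : Set (Fin n → ℂ)) : Prop :=
  IsOpen Ω ∧ IsConnected Ω ∧
    ∀ z ∈ Ω, ∀ w : Fin n → ℂ, (∀ j, ‖w j‖ ≤ ‖z j‖) → w ∈ Ω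

/-- `S(Ω₁, Ω₂) := inf {s > 0 : Ω₁ ⊆ s·Ω₂}`. -/
def SRatio {n : ℕ} (Ω₁ Ω₂ : Set (Fin n → ℂ)) : ℝ :=
  sInf {s : ℝ | 0 < s ∧ Ω₁ ⊆ s • Ω₂}

/-- The open unit polydisc `𝔻ⁿ`. -/
def polydisc (n : ℕ) : Set (Fin n → ℂ) := {z | ∀ j, ‖z j‖ < 1}

/-- The sup-norm of `f` over `Ω`. -/
def supNorm {n : ℕ} {E : Type*} [Norm E] (Ω : Set (Fin n → ℂ)) (f : (Fin n → ℂ) → E) : ℝ :=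
  ⨆ z ∈ Ω, ‖f z‖

/-- The `ℓ_q`-norm on `ℂⁿ` (`q = ∞` gives the max norm). -/
def lqNorm (n : ℕ) (q : ℝ≥0∞) (z : Fin n → ℂ) : ℝ :=
  if q = ∞ then ⨆ j, ‖z j‖
  else (∑ j, ‖z j‖ ^ q.toReal) ^ (1 / q.toReal)

/-- The open unit ball of `ℓⁿ_q`. -/
def lqBall (n : ℕ) (q : ℝ≥0∞) : Set (Fin n → ℂ) := {z | lqNorm n q z < 1}

/-- `N` is a norm on `ℂⁿ`. -/
def IsNorm {n : ℕ} (N : (Fin n → ℂ) → ℝ) : Prop :=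
  (∀ z, 0 ≤ N z) ∧ (∀ z, N z = 0 → z = 0) ∧
    (∀ (c : ℂ) (z), N (c • z) = ‖c‖ * N z) ∧ ∀ z w, N (z + w) ≤ N z + N w

/-- The canonical basis of `ℂⁿ` is normalized and 1-unconditional for the norm `N`. -/
def IsNormalized1Unconditional {n : ℕ} (N : (Fin n → ℂ) → ℝ) : Prop :=
  (∀ k, N (fun j => if j = k then 1 else 0) = 1) ∧
    ∀ ε μ : Fin n → ℂ, (∀ j, ‖ε j‖ ≤ 1) → N (fun j => ε j * μ j) ≤ N μ

/-- Open unit ball of the norm `N`. -/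
def unitBall {n : ℕ} (N : (Fin n → ℂ) → ℝ) : Set (Fin n → ℂ) := {z | N z < 1}

/-- Operator norm of the identity map `(ℂⁿ, N₁) → (ℂⁿ, N₂)`. -/
def idNorm {n : ℕ} (N₁ N₂ : (Fin n → ℂ) → ℝ) : ℝ :=
  sInf {c : ℝ | 0 ≤ c ∧ ∀ z, N₂ z ≤ c * N₁ z}

/-- `b_m(Ω) = (inf_{|α| = m} sup_{z ∈ Ω} |z^α|)^{-1/m}`. -/
def bCoef {n : ℕ} (Ω : Set (Fin n → ℂ)) (m : ℕ) : ℝ :=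
  (sInf ((fun α : Fin n → ℕ => ⨆ z ∈ Ω, ‖mpow z α‖) ''
      {α : Fin n → ℕ | ∑ j, α j = m})) ^ (-(1 / (m : ℝ)))

section Pluriharmonic

variable {n : ℕ} {H : Type*} [NormedAddCommGroup H] [InnerProductSpace ℂ H] [CompleteSpace H]
  {Y : Type*} [NormedAddCommGroup Y] [NormedSpace ℂ Y]

/-- `f` is a bounded pluriharmonic `B(H)`-valued function on `Ω`, given by coefficient
families `a`, `b` (with `b 0 = 0`): `f = Σ a_α z^α + Σ (b_α)* z̄^α`, both power series
converging locally uniformly on `Ω`, and `f` bounded on `Ω`. -/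
def IsBddPluriharmonic (Ω : Set (Fin n → ℂ)) (f : (Fin n → ℂ) → H →L[ℂ] H)
    (a b : (Fin n → ℕ) → H →L[ℂ] H) : Prop :=
  b 0 = 0 ∧
    (∃ h g : (Fin n → ℂ) → H →L[ℂ] H,
      TendstoLocallyUniformlyOn
        (fun (s : Finset (Fin n → ℕ)) z => ∑ α ∈ s, mpow z α • a α) h atTop Ω ∧
      TendstoLocallyUniformlyOn
        (fun (s : Finset (Fin n → ℕ)) z =>
          ∑ α ∈ s, mpow (star z) α • ContinuousLinearMap.adjoint (b α)) g atTop Ω ∧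
      ∀ z ∈ Ω, f z = h z + g z) ∧
    BddAbove ((fun z => ‖f z‖) '' Ω)

/-- The left-hand side `Σ_α sup_{z ∈ rΩ} (‖U a_α‖^p + ‖U b_α‖^p)|z^α|^p` of the second
Bohr inequality for pluriharmonic functions, valued in `ℝ≥0∞`. -/
def phBohrSum (Ω : Set (Fin n → ℂ)) (r p : ℝ) (U : (H →L[ℂ] H) →L[ℂ] Y)
    (a b : (Fin n → ℕ) → H →L[ℂ] H) : ℝ≥0∞ :=
  ∑' α : Fin n → ℕ, ⨆ z ∈ r • Ω,
    ENNReal.ofReal ((‖U (a α)‖ ^ p + ‖U (b α)‖ ^ p) * ‖mpow z α‖ ^ p)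

/-- The second `λ`-powered Bohr radius `L_λ(Ω, p, U)` for pluriharmonic functions. -/
def secondBohrPH (Ω : Set (Fin n → ℂ)) (p lam : ℝ) (U : (H →L[ℂ] H) →L[ℂ] Y) : ℝ :=
  sSup {r : ℝ | r ∈ Set.Icc (0 : ℝ) 1 ∧
    ∀ (f : (Fin n → ℂ) → H →L[ℂ] H) (a b : (Fin n → ℕ) → H →L[ℂ] H),
      IsBddPluriharmonic Ω f a b →
      phBohrSum Ω r p U a b ≤ ENNReal.ofReal (lam ^ p * supNorm Ω f ^ p)}

end Pluriharmonic

theorem integral_mFourier {n : ℕ} (k : Fin n → ℤ) :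
    ∫ t, UnitAddTorus.mFourier k t
      ∂(MeasureTheory.Measure.pi fun _ : Fin n => (AddCircle.haarAddCircle (T := (1 : ℝ)))) =
      if k = 0 then 1 else 0 := by
  split_ifs with hk
  · simp [hk, UnitAddTorus.mFourier_zero]
  · obtain ⟨i, hi⟩ := Function.ne_iff.mp hk
    have hfac : ∫ x : AddCircle (1 : ℝ), fourier (k i) x ∂AddCircle.haarAddCircle = 0 :=
      MeasureTheory.integral_eq_zero_of_add_right_eq_neg (fourier_add_half_inv_index hi one_pos)
    calc ∫ t, UnitAddTorus.mFourier k t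
          ∂(MeasureTheory.Measure.pi fun _ : Fin n => (AddCircle.haarAddCircle (T := (1 : ℝ))))
        = ∏ i, ∫ x : AddCircle (1 : ℝ), fourier (k i) x ∂AddCircle.haarAddCircle :=
          MeasureTheory.integral_fintype_prod_eq_prod (𝕜 := ℂ)
            (fun i (x : AddCircle (1 : ℝ)) => fourier (k i) x)
      _ = 0 := Finset.prod_eq_zero (Finset.mem_univ i) hfac

/-- Cauchy's estimate for the coefficients of a vector-valued trigonometric polynomial. -/
theorem norm_sum_coeff_le_of_trigPoly_le {n : ℕ} {ι E : Type*} [NormedAddCommGroup E]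
    [NormedSpace ℂ E] [CompleteSpace E] (s : Finset ι) (φ : ι → Fin n → ℤ) (c : ι → E)
    (k : Fin n → ℤ) {C : ℝ}
    (h : ∀ t, ‖∑ i ∈ s, UnitAddTorus.mFourier (φ i) t • c i‖ ≤ C) :
    ‖∑ i ∈ s, if φ i = k then c i else 0‖ ≤ C := by
  have hint : ∫ t, UnitAddTorus.mFourier (-k) t • ∑ i ∈ s, UnitAddTorus.mFourier (φ i) t • c i
      ∂(MeasureTheory.Measure.pi fun _ : Fin n => (AddCircle.haarAddCircle (T := (1 : ℝ)))) =
      ∑ i ∈ s, if φ i = k then c i else 0 := by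
    simp_rw [Finset.smul_sum, smul_smul, ← UnitAddTorus.mFourier_add]
    rw [MeasureTheory.integral_finsetSum]
    · refine Finset.sum_congr rfl fun i _ => ?_
      rw [integral_smul_const, integral_mFourier]
      simp [neg_add_eq_zero, eq_comm]
    · intro i _
      refine Continuous.integrable_of_hasCompactSupport ?_ (HasCompactSupport.of_compactSpace _)
      exact (ContinuousMap.continuous _).smul continuous_const
  rw [← hint]
  refine (MeasureTheory.norm_integral_le_of_norm_le_const (C := C) ?_).trans (by simp)
  refine .of_forall fun t => ?_
  have hone : ‖UnitAddTorus.mFourier (-k) t‖ = 1 := by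
    simp [UnitAddTorus.mFourier, fourier_apply, norm_prod, Circle.norm_coe]
  rw [norm_smul, hone, one_mul]
  exact h t

theorem mpow_torus {n : ℕ} (ρ : ℝ) (t : UnitAddTorus (Fin n)) (α : Fin n → ℕ) :
    mpow (fun j => (ρ : ℂ) * fourier 1 (t j)) α =
      (ρ : ℂ) ^ (∑ j, α j) * UnitAddTorus.mFourier (fun j => (α j : ℤ)) t := by
  simp only [mpow, mul_pow, Finset.prod_mul_distrib, Finset.prod_pow_eq_pow_sum]
  congr 1
  simp [UnitAddTorus.mFourier, fourier_apply, AddCircle.toCircle_nsmul]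

theorem mpow_star {n : ℕ} (z : Fin n → ℂ) (α : Fin n → ℕ) :
    mpow (star z) α = star (mpow z α) := by
  simp [mpow]

theorem norm_mpow_le {n : ℕ} {z : Fin n → ℂ} {R : ℝ} (hz : ∀ j, ‖z j‖ ≤ R) (α : Fin n → ℕ) :
    ‖mpow z α‖ ≤ R ^ (∑ j, α j) := by
  rw [mpow, norm_prod, ← Finset.prod_pow_eq_pow_sum]
  exact Finset.prod_le_prod (fun _ _ => norm_nonneg _) fun j _ => by
    rw [norm_pow]; exact pow_le_pow_left₀ (norm_nonneg _) (hz j) _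

/-- Cauchy's estimates for bounded operator-valued pluriharmonic functions. -/
theorem IsBddPluriharmonic.norm_coeff_le {n : ℕ} {H : Type*} [NormedAddCommGroup H]
    [InnerProductSpace ℂ H] [CompleteSpace H] {Ω : Set (Fin n → ℂ)} (hΩ : IsOpen Ω)
    {f : (Fin n → ℂ) → H →L[ℂ] H} {a b : (Fin n → ℕ) → H →L[ℂ] H}
    (hf : IsBddPluriharmonic Ω f a b) {M : ℝ} (hM : ∀ z ∈ Ω, ‖f z‖ ≤ M)
    {ρ : ℝ} (hρ : 0 ≤ ρ) (hsub : ∀ z : Fin n → ℂ, (∀ j, ‖z j‖ ≤ ρ) → z ∈ Ω) (α : Fin n → ℕ) :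
    ρ ^ (∑ j, α j) * ‖a α‖ ≤ M ∧ ρ ^ (∑ j, α j) * ‖b α‖ ≤ M := by
  obtain ⟨hb0, ⟨h, g, hh, hg, hfhg⟩, -⟩ := hf
  set K : Set (Fin n → ℂ) := Metric.closedBall 0 ρ
  have hK : IsCompact K := isCompact_closedBall 0 ρ
  have hKΩ : K ⊆ Ω := fun z hz => hsub z <| by
    rwa [mem_closedBall_zero_iff, pi_norm_le_iff_of_nonneg hρ] at hz
  rw [tendstoLocallyUniformlyOn_iff_forall_isCompact hΩ] at hh hg
  have key : ∀ ε > 0, ρ ^ (∑ j, α j) * ‖a α‖ ≤ M + ε ∧ ρ ^ (∑ j, α j) * ‖b α‖ ≤ M + ε := by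
    intro ε hε
    have e1 := Metric.tendstoUniformlyOn_iff.mp (hh K hKΩ hK) (ε / 2) (half_pos hε)
    have e2 := Metric.tendstoUniformlyOn_iff.mp (hg K hKΩ hK) (ε / 2) (half_pos hε)
    obtain ⟨s, ⟨hs1, hs2⟩, hαs⟩ := ((e1.and e2).and (eventually_ge_atTop {α})).exists
    have hαs : α ∈ s := by simpa using hαs
    set φ : (Fin n → ℕ) ⊕ (Fin n → ℕ) → Fin n → ℤ :=
      Sum.elim (fun β j => (β j : ℤ)) (fun β j => -(β j : ℤ)) with hφ
    set c : (Fin n → ℕ) ⊕ (Fin n → ℕ) → H →L[ℂ] H :=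
      Sum.elim (fun β => (ρ : ℂ) ^ (∑ j, β j) • a β)
        (fun β => (ρ : ℂ) ^ (∑ j, β j) • ContinuousLinearMap.adjoint (b β)) with hc
    have hbound : ∀ t, ‖∑ i ∈ s.disjSum s, UnitAddTorus.mFourier (φ i) t • c i‖ ≤ M + ε := by
      intro t
      set z : Fin n → ℂ := fun j => (ρ : ℂ) * fourier 1 (t j) with hz
      have hzK : z ∈ K := by
        rw [mem_closedBall_zero_iff, pi_norm_le_iff_of_nonneg hρ]
        intro j
        simp [hz, fourier_apply, abs_of_nonneg hρ, Circle.norm_coe]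
      have hsum : ∑ i ∈ s.disjSum s, UnitAddTorus.mFourier (φ i) t • c i =
          (∑ β ∈ s, mpow z β • a β) +
            ∑ β ∈ s, mpow (star z) β • ContinuousLinearMap.adjoint (b β) := by
        rw [Finset.sum_disjSum]
        congr 1
        · refine Finset.sum_congr rfl fun β _ => ?_
          rw [hz, mpow_torus, mul_comm, ← smul_smul]
          rfl
        · refine Finset.sum_congr rfl fun β _ => ?_
          have hneg : φ (Sum.inr β) = -fun j => (β j : ℤ) := rfl
          rw [mpow_star, hz, mpow_torus, hneg, UnitAddTorus.mFourier_neg, hc]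
          simp [smul_smul, mul_comm]
      rw [hsum]
      have h1 := hs1 z hzK
      have h2 := hs2 z hzK
      rw [dist_comm, dist_eq_norm] at h1 h2
      have h3 := hM z (hKΩ hzK)
      rw [hfhg z (hKΩ hzK)] at h3
      have h4 := norm_add₃_le (a := (∑ β ∈ s, mpow z β • a β) - h z)
        (b := (∑ β ∈ s, mpow (star z) β • ContinuousLinearMap.adjoint (b β)) - g z)
        (c := h z + g z)
      have h5 : ((∑ β ∈ s, mpow z β • a β) - h z) +
          ((∑ β ∈ s, mpow (star z) β • ContinuousLinearMap.adjoint (b β)) - g z) +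
          (h z + g z) = (∑ β ∈ s, mpow z β • a β) +
            ∑ β ∈ s, mpow (star z) β • ContinuousLinearMap.adjoint (b β) := by abel
      rw [h5] at h4
      linarith
    have hM0 : 0 ≤ M + ε := (norm_nonneg _).trans (hbound 0)
    have hcast : ∀ β γ : Fin n → ℕ,
        ((fun j => (β j : ℤ)) = fun j => (γ j : ℤ)) ↔ β = γ := fun β γ => by
      simp [funext_iff]
    have hneg : ∀ β γ : Fin n → ℕ,
        ((fun j => -(β j : ℤ)) = fun j => (γ j : ℤ)) ↔ β = 0 ∧ γ = 0 := fun β γ => by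
      simp only [funext_iff, ← forall_and, Pi.zero_apply]
      exact forall_congr' fun j => by omega
    have hneg' : ∀ β γ : Fin n → ℕ,
        ((fun j => (β j : ℤ)) = fun j => -(γ j : ℤ)) ↔ β = 0 ∧ γ = 0 := fun β γ => by
      simp only [funext_iff, ← forall_and, Pi.zero_apply]
      exact forall_congr' fun j => by omega
    have hnegneg : ∀ β γ : Fin n → ℕ,
        ((fun j => -(β j : ℤ)) = fun j => -(γ j : ℤ)) ↔ β = γ := fun β γ => by
      simp [funext_iff]
    constructor
    · have := norm_sum_coeff_le_of_trigPoly_le (s.disjSum s) φ c (fun j => (α j : ℤ)) hbound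
      rw [Finset.sum_disjSum] at this
      simp only [hφ, hc, Sum.elim_inl, Sum.elim_inr, hcast, hneg] at this
      rw [Finset.sum_ite_eq' s α, if_pos hαs, Finset.sum_eq_zero (s := s), add_zero, norm_smul]
        at this
      · simpa [abs_of_nonneg hρ] using this
      · intro β _
        split_ifs with hβ
        · simp [hβ.1, hb0]
        · rfl
    · by_cases hα : α = 0
      · simpa [hα, hb0] using hM0
      have := norm_sum_coeff_le_of_trigPoly_le (s.disjSum s) φ c (fun j => -(α j : ℤ)) hbound
      rw [Finset.sum_disjSum] at this
      simp only [hφ, hc, Sum.elim_inl, Sum.elim_inr, hneg', hnegneg, hα, and_false, if_false,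
        Finset.sum_const_zero, zero_add] at this
      rw [Finset.sum_ite_eq' s α, if_pos hαs, norm_smul, LinearIsometryEquiv.norm_map] at this
      simpa [abs_of_nonneg hρ] using this
  exact ⟨le_of_forall_pos_le_add fun ε hε => (key ε hε).1,
    le_of_forall_pos_le_add fun ε hε => (key ε hε).2⟩

theorem tsum_pow_sum (n : ℕ) (q : ℝ≥0∞) :
    ∑' α : Fin n → ℕ, q ^ (∑ j, α j) = ((1 - q)⁻¹) ^ n := by
  induction n with
  | zero => simp
  | succ n ih =>
    rw [← (Fin.consEquiv fun _ => ℕ).tsum_eq, ENNReal.tsum_prod']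
    simp [Fin.consEquiv, Fin.sum_univ_succ, pow_add, ENNReal.tsum_mul_left, ih,
      ENNReal.tsum_mul_right, ENNReal.tsum_geometric, pow_succ']

theorem IsCompleteReinhardt.zero_mem {n : ℕ} {Ω : Set (Fin n → ℂ)} (hR : IsCompleteReinhardt Ω) :
    (0 : Fin n → ℂ) ∈ Ω := by
  obtain ⟨z, hz⟩ := hR.2.1.nonempty
  exact hR.2.2 z hz 0 fun j => by simp

theorem SRatio_nonneg {n : ℕ} (Ω₁ Ω₂ : Set (Fin n → ℂ)) : 0 ≤ SRatio Ω₁ Ω₂ :=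
  Real.sInf_nonneg fun _ hs => hs.1.le

theorem norm_apply_le_SRatio_polydisc {n : ℕ} {Ω : Set (Fin n → ℂ)}
    (hb : Bornology.IsBounded Ω) {z : Fin n → ℂ} (hz : z ∈ Ω) (j : Fin n) :
    ‖z j‖ ≤ SRatio Ω (polydisc n) := by
  refine le_csInf ?_ ?_
  · obtain ⟨R, hR0, hR⟩ := hb.exists_pos_norm_lt
    refine ⟨R, hR0, fun w hw => (Set.mem_smul_set_iff_inv_smul_mem₀ hR0.ne' _ _).2 fun i => ?_⟩
    rw [Pi.smul_apply, norm_smul, norm_inv, Real.norm_of_nonneg hR0.le, inv_mul_lt_iff₀ hR0,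
      mul_one]
    exact (norm_le_pi_norm w i).trans_lt (hR w hw)
  · rintro s ⟨hs0, hs⟩
    have := (Set.mem_smul_set_iff_inv_smul_mem₀ hs0.ne' _ _).1 (hs hz) j
    rw [Pi.smul_apply, norm_smul, norm_inv, Real.norm_of_nonneg hs0.le, inv_mul_lt_iff₀ hs0,
      mul_one] at this
    exact this.le

theorem IsCompleteReinhardt.mem_of_mul_SRatio_lt_one {n : ℕ} {Ω : Set (Fin n → ℂ)}
    (hR : IsCompleteReinhardt Ω) {ρ : ℝ} (hρ : 0 < ρ) (hlt : ρ * SRatio (polydisc n) Ω < 1)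
    {z : Fin n → ℂ} (hz : ∀ j, ‖z j‖ ≤ ρ) : z ∈ Ω := by
  have hne : {t : ℝ | 0 < t ∧ polydisc n ⊆ t • Ω}.Nonempty := by
    obtain ⟨ε, hε, hball⟩ := Metric.isOpen_iff.mp hR.1 0 hR.zero_mem
    refine ⟨ε⁻¹, inv_pos.2 hε, fun w hw => ?_⟩
    rw [Set.mem_smul_set_iff_inv_smul_mem₀ (inv_pos.2 hε).ne', inv_inv]
    refine hball ?_
    rw [mem_ball_zero_iff, pi_norm_lt_iff hε]
    intro j
    rw [Pi.smul_apply, norm_smul, Real.norm_of_nonneg hε.le]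
    exact mul_lt_of_lt_one_right hε (hw j)
  have hlt' : SRatio (polydisc n) Ω < 1 / ρ := by rwa [lt_div_iff₀' hρ]
  obtain ⟨t, ⟨ht0, ht⟩, htρ⟩ := exists_lt_of_csInf_lt hne hlt'
  rw [lt_div_iff₀ hρ] at htρ
  have hmem : t • z ∈ polydisc n := fun j => by
    rw [Pi.smul_apply, norm_smul, Real.norm_of_nonneg ht0.le]
    exact (mul_le_mul_of_nonneg_left (hz j) ht0.le).trans_lt htρ
  exact (Set.smul_mem_smul_set_iff₀ ht0.ne' _ _).1 (ht hmem)

theorem IsCompleteReinhardt.one_le_SRatio_mul_SRatio {n : ℕ} (hn : 1 ≤ n) {Ω : Set (Fin n → ℂ)}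
    (hR : IsCompleteReinhardt Ω) (hb : Bornology.IsBounded Ω) :
    1 ≤ SRatio Ω (polydisc n) * SRatio (polydisc n) Ω := by
  have hS := SRatio_nonneg Ω (polydisc n)
  have hle : ∀ ρ > 0, ρ * SRatio (polydisc n) Ω < 1 → ρ ≤ SRatio Ω (polydisc n) := by
    intro ρ hρ hlt
    have hmem : (fun _ => (ρ : ℂ) : Fin n → ℂ) ∈ Ω :=
      hR.mem_of_mul_SRatio_lt_one hρ hlt fun j => by simp [abs_of_pos hρ]
    simpa [abs_of_pos hρ] using norm_apply_le_SRatio_polydisc hb hmem ⟨0, hn⟩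
  have hT : 0 < SRatio (polydisc n) Ω := by
    refine (SRatio_nonneg _ _).lt_of_ne' fun h0 => ?_
    have := hle (SRatio Ω (polydisc n) + 1) (by linarith) (by simp [h0])
    linarith
  rw [← div_le_iff₀ hT]
  refine le_of_forall_lt_imp_le_of_dense fun ρ hρ => ?_
  rcases le_or_gt ρ 0 with h0 | h0
  · exact h0.trans hS
  · exact hle ρ h0 ((lt_div_iff₀ hT).1 hρ)

theorem norm_le_supNorm {n : ℕ} {E : Type*} [SeminormedAddCommGroup E] {Ω : Set (Fin n → ℂ)}
    {f : (Fin n → ℂ) → E} (hf : BddAbove ((fun z => ‖f z‖) '' Ω)) {z : Fin n → ℂ} (hz : z ∈ Ω) :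
    ‖f z‖ ≤ supNorm Ω f := by
  obtain ⟨C, hC⟩ := hf
  have hbdd : BddAbove (Set.range fun w => ⨆ _ : w ∈ Ω, ‖f w‖) := by
    refine ⟨max C 0, ?_⟩
    rintro _ ⟨w, rfl⟩
    exact Real.iSup_le (fun hw => (hC ⟨w, hw, rfl⟩).trans (le_max_left _ _)) (le_max_right _ _)
  exact (ciSup_pos (f := fun _ => ‖f z‖) hz).ge.trans (le_ciSup hbdd z)

theorem IsBddPluriharmonic.norm_coeff_le_SRatio {n : ℕ} (hn : 1 ≤ n) {H : Type*}
    [NormedAddCommGroup H] [InnerProductSpace ℂ H] [CompleteSpace H] {Ω : Set (Fin n → ℂ)}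
    (hR : IsCompleteReinhardt Ω) (hb : Bornology.IsBounded Ω)
    {f : (Fin n → ℂ) → H →L[ℂ] H} {a b : (Fin n → ℕ) → H →L[ℂ] H}
    (hf : IsBddPluriharmonic Ω f a b) (α : Fin n → ℕ) :
    ‖a α‖ ≤ supNorm Ω f * SRatio (polydisc n) Ω ^ (∑ j, α j) ∧
      ‖b α‖ ≤ supNorm Ω f * SRatio (polydisc n) Ω ^ (∑ j, α j) := by
  set T := SRatio (polydisc n) Ω with hTdef
  have hT : 0 < T := by
    have h1 := hR.one_le_SRatio_mul_SRatio hn hb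
    refine (SRatio_nonneg _ _).lt_of_ne' fun h0 => ?_
    rw [h0, mul_zero] at h1
    linarith
  have hcauchy : ∀ ρ ∈ Set.Ioo 0 (1 / T),
      ρ ^ (∑ j, α j) * ‖a α‖ ≤ supNorm Ω f ∧ ρ ^ (∑ j, α j) * ‖b α‖ ≤ supNorm Ω f :=
    fun ρ hρ => hf.norm_coeff_le hR.1 (fun z hz => norm_le_supNorm hf.2.2 hz) hρ.1.le
      (fun z hz => hR.mem_of_mul_SRatio_lt_one hρ.1 ((lt_div_iff₀ hT).1 hρ.2) hz) α
  have hlim : ∀ A : ℝ, (∀ ρ ∈ Set.Ioo 0 (1 / T), ρ ^ (∑ j, α j) * A ≤ supNorm Ω f) →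
      A ≤ supNorm Ω f * T ^ (∑ j, α j) := by
    intro A hA
    have hcont : Continuous fun ρ : ℝ => ρ ^ (∑ j, α j) * A := by fun_prop
    have hle : (1 / T) ^ (∑ j, α j) * A ≤ supNorm Ω f :=
      le_of_tendsto (hcont.tendsto (1 / T) |>.mono_left nhdsWithin_le_nhds)
        (mem_of_superset (Ioo_mem_nhdsLT (one_div_pos.2 hT)) hA)
    rwa [one_div, inv_pow, inv_mul_le_iff₀ (pow_pos hT _), mul_comm] at hle
  exact ⟨hlim _ fun ρ hρ => (hcauchy ρ hρ).1, hlim _ fun ρ hρ => (hcauchy ρ hρ).2⟩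

theorem phBohrSum_le {n : ℕ} (hn : 1 ≤ n) {Ω : Set (Fin n → ℂ)} (hR : IsCompleteReinhardt Ω)
    (hb : Bornology.IsBounded Ω) {H : Type*} [NormedAddCommGroup H] [InnerProductSpace ℂ H]
    [CompleteSpace H] {Y : Type*} [NormedAddCommGroup Y] [NormedSpace ℂ Y]
    (U : (H →L[ℂ] H) →L[ℂ] Y) {p lam d r : ℝ} (hp : 1 ≤ p) (hr : 0 ≤ r)
    (hd1 : d < 1) (hU : 2 * ‖U‖ ^ p / (1 - d) ≤ lam ^ p + ‖U‖ ^ p) (hlam : 0 ≤ lam)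
    (hrd : (r * SRatio Ω (polydisc n) * SRatio (polydisc n) Ω) ^ p ≤ d / n)
    {f : (Fin n → ℂ) → H →L[ℂ] H} {a b : (Fin n → ℕ) → H →L[ℂ] H}
    (hf : IsBddPluriharmonic Ω f a b) :
    phBohrSum Ω r p U a b ≤ ENNReal.ofReal (lam ^ p * supNorm Ω f ^ p) := by
  have hp0 : 0 < p := one_pos.trans_le hp
  have hn0 : (0 : ℝ) < n := by exact_mod_cast hn
  set S := SRatio Ω (polydisc n) with hS
  set T := SRatio (polydisc n) Ω with hT
  set M := supNorm Ω f with hM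
  have hS0 : 0 ≤ S := SRatio_nonneg _ _
  have hT0 : 0 ≤ T := SRatio_nonneg _ _
  have hM0 : 0 ≤ M := (norm_nonneg _).trans (norm_le_supNorm hf.2.2 hR.zero_mem)
  set x := r * S * T with hx
  have hx0 : 0 ≤ x := by positivity
  set q := d / n with hq
  have hq0 : 0 ≤ q := (Real.rpow_nonneg hx0 p).trans hrd
  have hq1 : q < 1 := by
    have h1n : (1 : ℝ) ≤ n := by exact_mod_cast hn
    rw [hq, div_lt_one hn0]
    linarith
  set B := (‖U‖ * M) ^ p with hB
  have hB0 : 0 ≤ B := by positivity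
  have hcoef : ∀ (A : H →L[ℂ] H) (k : ℕ) (m : ℝ), 0 ≤ m → m ≤ (r * S) ^ k → ‖A‖ ≤ M * T ^ k →
      ‖U A‖ ^ p * m ^ p ≤ B * q ^ k := by
    intro A k m hm0 hm hA
    have h1 : ‖U A‖ * m ≤ ‖U‖ * M * x ^ k := by
      calc ‖U A‖ * m ≤ (‖U‖ * (M * T ^ k)) * (r * S) ^ k := by
            have := U.le_opNorm A
            gcongr
            exact this.trans (by gcongr)
        _ = ‖U‖ * M * x ^ k := by rw [hx, mul_pow (r * S)]; ring
    rw [← Real.mul_rpow (norm_nonneg _) hm0]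
    calc (‖U A‖ * m) ^ p ≤ (‖U‖ * M * x ^ k) ^ p := by gcongr
      _ = B * (x ^ p) ^ k := by
          rw [Real.mul_rpow (by positivity) (by positivity), Real.rpow_pow_comm hx0]
      _ ≤ B * q ^ k := by
          have : 0 ≤ x ^ p := Real.rpow_nonneg hx0 p
          gcongr
  have hterm : ∀ α : Fin n → ℕ,
      (⨆ z ∈ r • Ω, ENNReal.ofReal ((‖U (a α)‖ ^ p + ‖U (b α)‖ ^ p) * ‖mpow z α‖ ^ p)) +
        (if α = 0 then ENNReal.ofReal B else 0) ≤
      ENNReal.ofReal (2 * B) * ENNReal.ofReal q ^ (∑ j, α j) := by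
    intro α
    obtain ⟨ha, hbα⟩ := hf.norm_coeff_le_SRatio hn hR hb α
    have hz : ∀ z ∈ r • Ω, ‖mpow z α‖ ≤ (r * S) ^ (∑ j, α j) := by
      rintro _ ⟨w, hw, rfl⟩
      refine norm_mpow_le (fun j => ?_) α
      change ‖r • w j‖ ≤ r * S
      rw [norm_smul, Real.norm_of_nonneg hr]
      exact mul_le_mul_of_nonneg_left (norm_apply_le_SRatio_polydisc hb hw j) hr
    by_cases hα : α = 0
    · have hU0 : ‖U (b 0)‖ ^ p = 0 := by
        rw [hf.1, map_zero, norm_zero, Real.zero_rpow hp0.ne']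
      have h1 := fun z hz' => hcoef (a α) _ _ (norm_nonneg _) (hz z hz') ha
      subst hα
      simp only [if_true, Pi.zero_apply, Finset.sum_const_zero, pow_zero, mul_one, hU0, add_zero]
        at h1 ⊢
      rw [two_mul, ENNReal.ofReal_add hB0 hB0]
      gcongr
      exact iSup₂_le fun z hz' => ENNReal.ofReal_le_ofReal (h1 z hz')
    · rw [if_neg hα, add_zero, ← ENNReal.ofReal_pow hq0, ← ENNReal.ofReal_mul (by positivity)]
      refine iSup₂_le fun z hz' => ENNReal.ofReal_le_ofReal ?_
      have h1 := hcoef (a α) _ _ (norm_nonneg _) (hz z hz') ha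
      have h2 := hcoef (b α) _ _ (norm_nonneg _) (hz z hz') hbα
      linarith
  have hsum := ENNReal.tsum_le_tsum hterm
  rw [ENNReal.tsum_add, tsum_ite_eq, ENNReal.tsum_mul_left, tsum_pow_sum] at hsum
  have hgeom : ENNReal.ofReal (2 * B) * ((1 - ENNReal.ofReal q)⁻¹) ^ n ≤
      ENNReal.ofReal (lam ^ p * M ^ p) + ENNReal.ofReal B := by
    rw [← ENNReal.ofReal_one, ← ENNReal.ofReal_sub _ hq0,
      ← ENNReal.ofReal_inv_of_pos (by linarith), ← ENNReal.ofReal_pow (by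
        rw [inv_nonneg]; linarith), ← ENNReal.ofReal_mul (by positivity),
      ← ENNReal.ofReal_add (by positivity) hB0]
    apply ENNReal.ofReal_le_ofReal
    have hbern : 1 - d ≤ (1 - q) ^ n := by
      have h1 := one_add_mul_le_pow (a := -q) (by linarith) n
      have h2 : (n : ℝ) * -q = -d := by rw [hq]; field_simp
      rw [h2] at h1
      simpa [sub_eq_add_neg] using h1
    have hd0 : 0 < 1 - d := by linarith
    calc 2 * B * ((1 - q)⁻¹) ^ n ≤ 2 * B * (1 - d)⁻¹ := by
          rw [inv_pow]
          gcongr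
      _ = (2 * ‖U‖ ^ p / (1 - d)) * M ^ p := by
          rw [hB, Real.mul_rpow (norm_nonneg _) hM0]
          ring
      _ ≤ (lam ^ p + ‖U‖ ^ p) * M ^ p := by gcongr
      _ = lam ^ p * M ^ p + B := by rw [hB, Real.mul_rpow (norm_nonneg _) hM0]; ring
  exact (ENNReal.add_le_add_iff_right ENNReal.ofReal_ne_top).1 (hsum.trans hgeom)

/-- Bounds for the constant `D` in the lower bound for the second Bohr radius. -/
theorem bohrConstant_bounds {u p lam D : ℝ} (hu0 : 0 < u) (hp : 1 ≤ p) (hlam : 1 < lam)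
    (hu : u < lam)
    (hD : D = if 1 / (4 * lam * (2 : ℝ) ^ (1 / p)) ≤ u then
        max ((1 / (4 * lam * (2 : ℝ) ^ (1 / p))) *
              ((lam ^ p - u ^ p) / (2 * lam ^ p - u ^ p)) ^ (1 / p))
          ((1 / (4 * lam * (2 : ℝ) ^ (1 / p))) *
              ((lam ^ p - u ^ p) / (lam ^ p - u ^ p + 1)) ^ (1 / p) * (1 / u))
      else
        max ((1 / (4 * lam * (2 : ℝ) ^ (1 / p))) *
              ((lam ^ p - u ^ p) / (2 * lam ^ p - u ^ p)) ^ (1 / p))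
          ((1 / (4 * lam * (2 : ℝ) ^ (1 / p))) *
              ((lam ^ p - u ^ p) / (lam ^ p - u ^ p + 1)) ^ (1 / p))) :
    0 ≤ D ∧ D ^ p ≤ (lam ^ p - u ^ p) / (lam ^ p + u ^ p) := by
  have hp0 : 0 < p := one_pos.trans_le hp
  have hlam0 : 0 < lam := one_pos.trans hlam
  set κ := 1 / (4 * lam * (2 : ℝ) ^ (1 / p)) with hκ
  have hκ0 : 0 < κ := by positivity
  have hc : 1 < lam ^ p := Real.one_lt_rpow hlam hp0
  have hv0 : 0 < u ^ p := Real.rpow_pos_of_pos hu0 p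
  have hvc : u ^ p < lam ^ p := Real.rpow_lt_rpow hu0.le hu hp0
  have hw : 8 * κ ^ p * lam ^ p ≤ 1 := by
    have h4 : (4 : ℝ) ≤ 4 ^ p := by
      simpa using Real.rpow_le_rpow_of_exponent_le (by norm_num : (1 : ℝ) ≤ 4) hp
    rw [hκ, Real.div_rpow one_pos.le (by positivity), Real.mul_rpow (by positivity) (by positivity),
      Real.mul_rpow (by positivity) hlam0.le, ← Real.rpow_mul (by positivity),
      one_div_mul_cancel hp0.ne', Real.rpow_one, Real.one_rpow]
    have : 8 * (1 / (4 ^ p * lam ^ p * 2)) * lam ^ p = 4 / 4 ^ p := by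
      field_simp
      norm_num
    rw [this]
    exact div_le_one_of_le₀ h4 (by positivity)
  have hw0 : 0 < κ ^ p := Real.rpow_pos_of_pos hκ0 p
  have hroot : ∀ X : ℝ, 0 ≤ X → (X ^ (1 / p)) ^ p = X := fun X hX => by
    rw [← Real.rpow_mul hX, one_div_mul_cancel hp0.ne', Real.rpow_one]
  set c := lam ^ p with hcdef
  set v := u ^ p with hvdef
  set w := κ ^ p with hwdef
  have hw8 : 8 * w ≤ 1 := by nlinarith
  have hX1 : 0 ≤ (c - v) / (2 * c - v) := div_nonneg (by linarith) (by linarith)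
  have hX2 : 0 ≤ (c - v) / (c - v + 1) := div_nonneg (by linarith) (by linarith)
  have hfirst : 0 ≤ κ * ((c - v) / (2 * c - v)) ^ (1 / p) ∧
      (κ * ((c - v) / (2 * c - v)) ^ (1 / p)) ^ p ≤ (c - v) / (c + v) := by
    refine ⟨by positivity, ?_⟩
    rw [Real.mul_rpow hκ0.le (by positivity), hroot _ hX1, ← hwdef, ← mul_div_assoc,
      div_le_div_iff₀ (by linarith) (by linarith), mul_comm w, mul_assoc]
    refine mul_le_mul_of_nonneg_left ?_ (by linarith)
    nlinarith
  have hsecond : κ ≤ u → 0 ≤ κ * ((c - v) / (c - v + 1)) ^ (1 / p) * (1 / u) ∧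
      (κ * ((c - v) / (c - v + 1)) ^ (1 / p) * (1 / u)) ^ p ≤ (c - v) / (c + v) := by
    intro h
    have hwv : w ≤ v := Real.rpow_le_rpow hκ0.le h hp0.le
    refine ⟨by positivity, ?_⟩
    rw [Real.mul_rpow (by positivity) (by positivity), Real.mul_rpow hκ0.le (by positivity),
      hroot _ hX2, Real.div_rpow one_pos.le hu0.le, Real.one_rpow, ← hwdef, ← hvdef]
    have : w * ((c - v) / (c - v + 1)) * (1 / v) = (c - v) * w / ((c - v + 1) * v) := by
      have : c - v + 1 ≠ 0 := by linarith
      field_simp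
    rw [this, div_le_div_iff₀ (mul_pos (by linarith) hv0) (by linarith), mul_assoc]
    refine mul_le_mul_of_nonneg_left ?_ (by linarith)
    nlinarith [mul_nonneg (sub_nonneg.2 hwv) (sub_nonneg.2 hvc.le)]
  have hthird : ¬ κ ≤ u → 0 ≤ κ * ((c - v) / (c - v + 1)) ^ (1 / p) ∧
      (κ * ((c - v) / (c - v + 1)) ^ (1 / p)) ^ p ≤ (c - v) / (c + v) := by
    intro h
    have hvw : v ≤ w := Real.rpow_le_rpow hu0.le (not_le.1 h).le hp0.le
    refine ⟨by positivity, ?_⟩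
    rw [Real.mul_rpow hκ0.le (by positivity), hroot _ hX2, ← hwdef, ← mul_div_assoc,
      div_le_div_iff₀ (by linarith) (by linarith), mul_comm w, mul_assoc]
    refine mul_le_mul_of_nonneg_left ?_ (by linarith)
    nlinarith
  split_ifs at hD with h
  · rcases max_choice (κ * ((c - v) / (2 * c - v)) ^ (1 / p))
      (κ * ((c - v) / (c - v + 1)) ^ (1 / p) * (1 / u)) with hm | hm <;> rw [hD, hm]
    exacts [hfirst, hsecond h]
  · rcases max_choice (κ * ((c - v) / (2 * c - v)) ^ (1 / p))
      (κ * ((c - v) / (c - v + 1)) ^ (1 / p)) with hm | hm <;> rw [hD, hm]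
    exacts [hfirst, hthird h]

/-- positivity lower bound for the second Bohr radius of pluriharmonic
functions (Theorem 1.1). -/
theorem second_bohr_PH_lower_bound {n : ℕ} (hn : 1 ≤ n) (Ω : Set (Fin n → ℂ))
    (hR : IsCompleteReinhardt Ω) (hb : Bornology.IsBounded Ω)
    (hs : SimplyConnectedSpace Ω)
    {H : Type*} [NormedAddCommGroup H] [InnerProductSpace ℂ H] [CompleteSpace H]
    {Y : Type*} [NormedAddCommGroup Y] [NormedSpace ℂ Y] [CompleteSpace Y]
    (U : (H →L[ℂ] H) →L[ℂ] Y) (p lam : ℝ) (hp : 1 ≤ p) (hlam : 1 < lam)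
    (hU0 : U ≠ 0) (hU : ‖U‖ < lam)
    (D : ℝ)
    (hD : D = if 1 / (4 * lam * (2 : ℝ) ^ (1 / p)) ≤ ‖U‖ then
        max ((1 / (4 * lam * (2 : ℝ) ^ (1 / p))) *
              ((lam ^ p - ‖U‖ ^ p) / (2 * lam ^ p - ‖U‖ ^ p)) ^ (1 / p))
          ((1 / (4 * lam * (2 : ℝ) ^ (1 / p))) *
              ((lam ^ p - ‖U‖ ^ p) / (lam ^ p - ‖U‖ ^ p + 1)) ^ (1 / p) * (1 / ‖U‖))
      else
        max ((1 / (4 * lam * (2 : ℝ) ^ (1 / p))) *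
              ((lam ^ p - ‖U‖ ^ p) / (2 * lam ^ p - ‖U‖ ^ p)) ^ (1 / p))
          ((1 / (4 * lam * (2 : ℝ) ^ (1 / p))) *
              ((lam ^ p - ‖U‖ ^ p) / (lam ^ p - ‖U‖ ^ p + 1)) ^ (1 / p)))
    :
    D * (n : ℝ) ^ (-(1 / p)) / (SRatio Ω (polydisc n) * SRatio (polydisc n) Ω) ≤
      secondBohrPH Ω p lam U := by
  have hp0 : 0 < p := one_pos.trans_le hp
  have hlam0 : 0 < lam := one_pos.trans hlam
  have hu0 : 0 < ‖U‖ := norm_pos_iff.2 hU0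
  obtain ⟨hD0, hDp⟩ := bohrConstant_bounds hu0 hp hlam hU hD
  have hv0 : 0 < ‖U‖ ^ p := Real.rpow_pos_of_pos hu0 p
  have hc0 : 0 < lam ^ p := Real.rpow_pos_of_pos hlam0 p
  have hD1 : D ^ p < 1 := hDp.trans_lt <| by rw [div_lt_one (by linarith)]; linarith
  have hD1' : D ≤ 1 := by
    by_contra! h
    exact (Real.one_lt_rpow h hp0).not_gt hD1
  have hn1 : (1 : ℝ) ≤ n := by exact_mod_cast hn
  have hST := hR.one_le_SRatio_mul_SRatio hn hb
  have hST0 := one_pos.trans_le hST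
  have hnp : (n : ℝ) ^ (-(1 / p)) ≤ 1 :=
    Real.rpow_le_one_of_one_le_of_nonpos hn1 (by simpa using hp0.le)
  have hnp0 : 0 ≤ (n : ℝ) ^ (-(1 / p)) := by positivity
  have hr0 : 0 ≤ D * (n : ℝ) ^ (-(1 / p)) / (SRatio Ω (polydisc n) * SRatio (polydisc n) Ω) :=
    div_nonneg (mul_nonneg hD0 hnp0) hST0.le
  refine le_csSup ⟨1, fun r hr => hr.1.2⟩ ⟨⟨hr0, ?_⟩, fun f a b hf => ?_⟩
  · exact div_le_one_of_le₀ ((mul_le_one₀ hD1' hnp0 hnp).trans hST) hST0.le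
  · refine phBohrSum_le hn hR hb U (d := D ^ p) hp hr0 hD1 ?_ hlam0.le ?_ hf
    · rw [div_le_iff₀ (by linarith)]
      rw [le_div_iff₀ (by linarith)] at hDp
      linarith
    · rw [mul_assoc, div_mul_cancel₀ _ hST0.ne', Real.mul_rpow hD0 hnp0,
        ← Real.rpow_mul (by positivity), neg_mul, one_div_mul_cancel hp0.ne', Real.rpow_neg_one,
        div_eq_mul_inv]

end BohrPaper
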